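/- arXiv:2110.13464 — 3 statements merged into one kernel-verified Lean document; each statement's English description precedes it below -/
import Mathlib

section
/- (Proposition 1, dominant strategy equilibrium.) Suppose each firm i chooses a strategy x_i ∈ [0, D_i] (the amount of local data used for FL training), its post-FL loss L'_i is a strictly decreasing function of its own strategy x_i and does not depend on the strategies of the other firms, its improvement d_i(x_i) = L_i − L'_i(x_i) satisfies d_i(x_i) ≥ 0 for all x_i ∈ [0,D_i], and for any strategy profile the total improvement Σ_j d_j(x_j) > 0. If the relative service-quality improvements are S_i = d_i(x_i)/Σ_j d_j(x_j) and post-FL market shares MS'_i are computed from S as in the market model, then for every firm i, every alternative x'_i ∈ [0, D_i], and every profile x_{−i} of the other firms' strategies, MS'_i evaluated at (D_i, x_{−i}) is at least MS'_i evaluated at (x'_i, x_{−i}); i.e., the profile (D_1, …, D_n) is a dominant strategy equilibrium for market-share payoffs. -/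
/-- The share `a / (a + c)` is monotone in `a` when `c` is nonnegative. -/
theorem div_add_le_div_add_of_le {a b c : ℝ} (hab : a ≤ b) (hc : 0 ≤ c)
    (ha : 0 < a + c) : a / (a + c) ≤ b / (b + c) := by
  rw [div_le_div_iff₀ ha (by linarith)]
  nlinarith [mul_le_mul_of_nonneg_right hab hc]

/-- Proposition 1, dominant strategy equilibrium.  Each firm
`i` chooses `x_i ∈ [0, D_i]`; its post-FL loss `L'_i` is strictly decreasing in
`x_i` and does not depend on others' strategies, improvements
`d_i(x_i) = L_i - L'_i(x_i)` are nonnegative and totals are positive.  With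
`S_i = d_i(x_i) / ∑_j d_j(x_j)` and market shares computed from `S`, using all
local data (`x_i = D_i`) is a dominant strategy for every firm. -/
theorem dominant_strategy_equilibrium
    (n : ℕ) (MS r ν D L : Fin n → ℝ) (θ : ℝ) (L' : Fin n → ℝ → ℝ)
    (hMS : ∀ i, 0 < MS i ∧ MS i < 1) (hMSsum : ∑ i, MS i = 1)
    (hr : ∀ i, 0 ≤ r i ∧ r i ≤ 1)
    (hν : ∀ i, 0 ≤ ν i ∧ ν i ≤ 1 - r i)
    (hθ : 0 ≤ θ)
    (he : 0 < 1 + θ - ∑ j, ν j * MS j)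
    (hD : ∀ i, 0 < D i)
    (hanti : ∀ i, StrictAntiOn (L' i) (Set.Icc 0 (D i)))
    (himpr : ∀ i, ∀ x ∈ Set.Icc (0 : ℝ) (D i), 0 ≤ L i - L' i x)
    (htot : ∀ x : Fin n → ℝ, (∀ j, x j ∈ Set.Icc (0 : ℝ) (D j)) →
      0 < ∑ j, (L j - L' j (x j)))
    (i : Fin n) (x : Fin n → ℝ) (hx : ∀ j, x j ∈ Set.Icc (0 : ℝ) (D j))
    (x'i : ℝ) (hx'i : x'i ∈ Set.Icc (0 : ℝ) (D i)) :
    let MS' : (Fin n → ℝ) → ℝ := fun y =>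
      (r i * MS i
        + ((L i - L' i (y i)) / ∑ j, (L j - L' j (y j)))
            * ∑ j, (1 - r j - ν j) * MS j
        + ((L i - L' i (y i)) / ∑ j, (L j - L' j (y j))) * θ) /
        (1 + θ - ∑ j, ν j * MS j)
    MS' (Function.update x i x'i) ≤ MS' (Function.update x i (D i)) := by
  intro MS'
  have hsum : ∀ z : ℝ, ∑ j, (L j - L' j (Function.update x i z j))
      = (L i - L' i z) + ∑ j ∈ Finset.univ.erase i, (L j - L' j (x j)) := by
    intro z
    rw [← Finset.add_sum_erase _ _ (Finset.mem_univ i), Function.update_self]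
    congr 1
    refine Finset.sum_congr rfl fun j hj => ?_
    rw [Function.update_of_ne (Finset.ne_of_mem_erase hj)]
  have hrest : 0 ≤ ∑ j ∈ Finset.univ.erase i, (L j - L' j (x j)) :=
    Finset.sum_nonneg fun j _ => himpr j _ (hx j)
  have hpos := htot (Function.update x i x'i) fun j => by
    rcases eq_or_ne j i with rfl | hj
    · rwa [Function.update_self]
    · rw [Function.update_of_ne hj]
      exact hx j
  rw [hsum] at hpos
  have hloss : L' i (D i) ≤ L' i x'i :=
    (hanti i).antitoneOn hx'i (Set.right_mem_Icc.2 (hD i).le) hx'i.2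
  have hshare := div_add_le_div_add_of_le (sub_le_sub_left hloss (L i)) hrest hpos
  have hswitch : 0 ≤ ∑ j, (1 - r j - ν j) * MS j :=
    Finset.sum_nonneg fun j _ => mul_nonneg (by linarith [(hν j).2]) (hMS j).1.le
  simp only [MS', hsum, Function.update_self]
  gcongr
end

section
/- (Proposition 4, viability of FL.) Let C' = { i : Q̂_i^min > 0 } with n' = |C'| ≥ 1. Then the friendliness satisfies κ ≥ 0 (equivalently, there exists a feasible allocation of relative improvements achieving market δ-stability) if and only if ( Σ_{i∈C'} (MS_i − r̂_i) − f_o ) / n' ≤ δ. -/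
open Finset in
/-- The sum of the positive parts is the sum over the positive terms. -/
theorem sum_max_zero_eq_sum_filter_pos {ι : Type*} (s : Finset ι) (f : ι → ℝ)
    [DecidablePred fun i => 0 < f i] :
    ∑ i ∈ s, max (f i) 0 = ∑ i ∈ s with 0 < f i, f i := by
  rw [sum_filter]
  refine sum_congr rfl fun i _ => ?_
  split_ifs with h
  · exact max_eq_left h.le
  · exact max_eq_right (not_lt.mp h)

open Classical in
/-- Proposition 4, viability of FL.  With
`C' = {i : Q̂_i^min > 0}` and `n' = |C'| ≥ 1`, the friendliness satisfies
`κ ≥ 0` if and only if `(∑_{i ∈ C'} (MS_i - r̂_i) - f_o) / n' ≤ δ`. -/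
theorem FL_viability
    (n : ℕ) (MS r ν : Fin n → ℝ) (θ δ : ℝ)
    (hMS : ∀ i, 0 < MS i ∧ MS i < 1) (hMSsum : ∑ i, MS i = 1)
    (hr : ∀ i, 0 ≤ r i ∧ r i ≤ 1)
    (hν : ∀ i, 0 ≤ ν i ∧ ν i ≤ 1 - r i)
    (hθ : 0 ≤ θ)
    (he : 0 < 1 + θ - ∑ j, ν j * MS j)
    (hfo : 0 < (θ + ∑ j, (1 - r j - ν j) * MS j) / (1 + θ - ∑ j, ν j * MS j))
    (hδ : -1 < δ ∧ δ < 1) :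
    let e : ℝ := 1 + θ - ∑ j, ν j * MS j
    let fo : ℝ := (θ + ∑ j, (1 - r j - ν j) * MS j) / e
    let rhat : Fin n → ℝ := fun i => r i * MS i / e
    let Qhat : Fin n → ℝ := fun i => (MS i - δ - rhat i) / fo
    let C' : Finset (Fin n) := Finset.univ.filter (fun i => 0 < Qhat i)
    let κ : ℝ := 1 - ∑ i, max (Qhat i) 0
    1 ≤ C'.card →
    (0 ≤ κ ↔ ((∑ i ∈ C', (MS i - rhat i)) - fo) / (C'.card : ℝ) ≤ δ) := by
  intro e fo rhat Qhat C' κ hC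
  have hfo_pos : 0 < fo := hfo
  have hcard : (0 : ℝ) < C'.card := by exact_mod_cast hC
  have hsum : ∑ i, max (Qhat i) 0 = ((∑ i ∈ C', (MS i - rhat i)) - C'.card * δ) / fo := by
    rw [sum_max_zero_eq_sum_filter_pos, ← nsmul_eq_mul, ← Finset.sum_const,
      ← Finset.sum_sub_distrib, Finset.sum_div]
    exact Finset.sum_congr rfl fun i _ => by simp only [Qhat, sub_right_comm]
  change 0 ≤ 1 - ∑ i, max (Qhat i) 0 ↔ _
  rw [hsum, sub_nonneg, div_le_one hfo_pos, div_le_iff₀ hcard]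
  constructor <;> intro h <;> linarith
end

section
/- (Faster-growing markets impose stricter requirements.) Fix δ > 0, r_o > 0, ν_o ∈ [0, 1−r_o], and MS_i. The symmetric-market bound Q̂_i^min(θ) = MS_i − δ·(1+θ−ν_o)/(1+θ−ν_o−r_o) is a strictly increasing function of the growth rate θ on the set of θ ≥ 0 with 1+θ−ν_o−r_o > 0. -/
/-- Faster-growing markets impose stricter requirements.  For
fixed `δ > 0`, `r_o > 0`, `ν_o ∈ [0, 1 - r_o]`, and `MS_i`, the symmetric-market
bound `Q̂_i^min(θ) = MS_i - δ·(1+θ-ν_o)/(1+θ-ν_o-r_o)` is strictly increasing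
in the growth rate `θ` on `{θ | θ ≥ 0 ∧ 1+θ-ν_o-r_o > 0}`. -/
theorem bound_strictMono_in_growth
    (MSi δ ro νo : ℝ)
    (hδ : 0 < δ)
    (hro : 0 < ro)
    (hνo : 0 ≤ νo ∧ νo ≤ 1 - ro) :
    StrictMonoOn (fun θ : ℝ => MSi - δ * (1 + θ - νo) / (1 + θ - νo - ro))
      {θ : ℝ | 0 ≤ θ ∧ 0 < 1 + θ - νo - ro} := by
  rintro a ⟨-, ha⟩ b ⟨-, hb⟩ hab
  refine sub_lt_sub_left ?_ MSi
  rw [div_lt_div_iff₀ hb ha]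
  nlinarith [mul_pos (mul_pos hδ hro) (sub_pos.2 hab)]
end
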